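/- If I is an ideal of A such that f(I)B = B (i.e., the ideal of B generated by f(I) is all of B), then the extension of I to A⋈^f J equals I⋈^f J, that is, I·(A⋈^f J) = {(i, f(i)+j) : i ∈ I, j ∈ J}. -/

import Mathlib

section Amalgamation

variable {A B : Type*} [CommRing A] [CommRing B]

/-- The amalgamation `A ⋈^f J` of `A` with `B` along the ideal `J` of `B` with respect to
the ring homomorphism `f : A → B`, realized as the subring
`{(a, f a + j) | a ∈ A, j ∈ J}` of `A × B`. -/
def amalg (f : A →+* B) (J : Ideal B) : Subring (A × B) where
  carrier := {x : A × B | x.2 - f x.1 ∈ J}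
  zero_mem' := by simp
  one_mem' := by simp
  add_mem' := by
    intro x y hx hy
    simp only [Set.mem_setOf_eq, Prod.fst_add, Prod.snd_add, map_add] at *
    have h : x.2 + y.2 - (f x.1 + f y.1) = x.2 - f x.1 + (y.2 - f y.1) := by ring
    rw [h]; exact J.add_mem hx hy
  neg_mem' := by
    intro x hx
    simp only [Set.mem_setOf_eq, Prod.fst_neg, Prod.snd_neg, map_neg] at *
    have h : -x.2 - -f x.1 = -(x.2 - f x.1) := by ring
    rw [h]; exact J.neg_mem hx
  mul_mem' := by
    intro x y hx hy
    simp only [Set.mem_setOf_eq, Prod.fst_mul, Prod.snd_mul, map_mul] at *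
    have h : x.2 * y.2 - f x.1 * f y.1 = x.2 * (y.2 - f y.1) + (x.2 - f x.1) * f y.1 := by ring
    rw [h]
    exact J.add_mem (J.mul_mem_left _ hy) (J.mul_mem_right _ hx)

lemma mem_amalg_iff (f : A →+* B) (J : Ideal B) (x : A × B) :
    x ∈ amalg f J ↔ x.2 - f x.1 ∈ J := Iff.rfl

/-- The canonical embedding `ι : A → A ⋈^f J`, `a ↦ (a, f a)`. -/
def iota (f : A →+* B) (J : Ideal B) : A →+* amalg f J :=
  ((RingHom.id A).prod f).codRestrict (amalg f J) (fun a => by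
    simp [mem_amalg_iff])

end Amalgamation

section Extension

variable {A B : Type*} [CommRing A] [CommRing B]

lemma coe_iota (f : A →+* B) (J : Ideal B) (a : A) : (iota f J a : A × B) = (a, f a) := rfl

/-- The element `(0, j)` of `A ⋈^f J`, for `j ∈ J`. -/
def amalgInr (f : A →+* B) (J : Ideal B) (j : J) : amalg f J :=
  ⟨(0, j), by simp [mem_amalg_iff]⟩

lemma amalgInr_smul_mem_map_iota (f : A →+* B) (J : Ideal B) (I : Ideal A) {b : B}
    (hb : b ∈ Ideal.map f I) (j : J) :
    amalgInr f J (b • j) ∈ Ideal.map (iota f J) I := by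
  induction hb using Submodule.span_induction generalizing j with
  | mem b hb =>
    obtain ⟨i, hi, rfl⟩ := hb
    have h : amalgInr f J (f i • j) = amalgInr f J j * iota f J i := by
      ext <;> simp [amalgInr, coe_iota, mul_comm]
    rw [h]
    exact Ideal.mul_mem_left _ _ (Ideal.mem_map_of_mem _ hi)
  | zero =>
    have h : amalgInr f J ((0 : B) • j) = 0 := by
      ext <;> simp [amalgInr]
    rw [h]
    exact Ideal.zero_mem _
  | add b c _ _ hb hc =>
    have h : amalgInr f J ((b + c) • j) = amalgInr f J (b • j) + amalgInr f J (c • j) := by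
      ext <;> simp [amalgInr, add_mul]
    rw [h]
    exact Ideal.add_mem _ (hb j) (hc j)
  | smul c b _ hb =>
    rw [smul_assoc, smul_comm]
    exact hb (c • j)

lemma fst_mem_of_mem_map_iota (f : A →+* B) (J : Ideal B) (I : Ideal A) {x : amalg f J}
    (hx : x ∈ Ideal.map (iota f J) I) : (x : A × B).1 ∈ I := by
  have h : Ideal.map (iota f J) I ≤ I.comap ((RingHom.fst A B).comp (amalg f J).subtype) :=
    Ideal.map_le_iff_le_comap.2 fun _ hi => hi
  exact h hx

end Extension

/-- If `I` is an ideal of `A` with `f(I)B = B`, then the extension of `I` to `A ⋈^f J`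
equals `I ⋈^f J = {(i, f i + j) | i ∈ I, j ∈ J}`. -/
theorem stmt13 {A B : Type*} [CommRing A] [CommRing B] (f : A →+* B) (J : Ideal B)
    (I : Ideal A) (h : Ideal.map f I = ⊤) :
    ((Ideal.map (iota f J) I : Ideal (amalg f J)) : Set (amalg f J)) =
      {x : amalg f J | ∃ i ∈ I, ∃ j ∈ J, (x : A × B) = (i, f i + j)} := by
  ext x
  simp only [SetLike.mem_coe, Set.mem_ofPred_eq]
  constructor
  · intro hx
    exact ⟨_, fst_mem_of_mem_map_iota f J I hx, _, x.2, by ext <;> simp⟩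
  · rintro ⟨i, hi, j, hj, hx⟩
    have key := amalgInr_smul_mem_map_iota f J I (h ▸ Submodule.mem_top : (1 : B) ∈ _) ⟨j, hj⟩
    rw [one_smul] at key
    have hsum : x = iota f J i + amalgInr f J ⟨j, hj⟩ := by
      apply Subtype.ext
      rw [hx]
      ext <;> simp [amalgInr, coe_iota]
    rw [hsum]
    exact Ideal.add_mem _ (Ideal.mem_map_of_mem _ hi) key
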